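/- arXiv:2605.31441 — 2 statements merged into one kernel-verified Lean document; each statement's English description precedes it below -/
import Mathlib

section
/- Let β ≥ 2 and let G be a finite connected graph with n vertices satisfying strengthened Ahlfors β-regularity up to scale R̄ with constants 0 < v_* ≤ v^*. Then for every integer R with 0 < R ≤ R̄/5 there exist vertices q₁,…,q_l of G and integers t₁,…,t_l with R+1 ≤ t_i ≤ 2R such that: (i) the balls B(q_i,t_i), 1 ≤ i ≤ l, cover the vertex set of G, and l ≤ (2^β·β/v_*)·n/R^β; (ii) for every i, the number of indices j ≠ i with ∂B(q_i,t_i) ∩ ∂B(q_j,t_j) ≠ ∅ is at most M := (v^*/v_*)·10^β; (iii) for all i ≠ j and every δ ∈ {−1, 0, +1}, Vol(∂B(q_i,t_i+δ) ∩ ∂B(q_j,t_j)) ≤ w₂·R^{β−2}, where w₂ := 3·2^{β−1}·M·v^*. -/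
open Set

/-- The closed ball of (real) radius `R` about a vertex `q` of a graph `G`, for the
shortest-path metric. -/
def gball {V : Type*} (G : SimpleGraph V) (q : V) (R : ℝ) : Set V :=
  {p | ((G.dist q p : ℝ)) ≤ R}

/-- The sphere of radius `R ∈ ℕ` about a vertex `q` of a graph `G`. -/
def gsphere {V : Type*} (G : SimpleGraph V) (q : V) (R : ℕ) : Set V :=
  {p | G.dist q p = R}

/-- The sphere of integer radius `m ∈ ℤ` about a vertex `q` of a graph `G`. -/
def gsphereZ {V : Type*} (G : SimpleGraph V) (q : V) (m : ℤ) : Set V :=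
  {p | (G.dist q p : ℤ) = m}

lemma rpow_tangent_le {a b p : ℝ} (ha : 0 < a) (hb : 0 ≤ b) (hp : 1 ≤ p) :
    a ^ p + p * a ^ (p - 1) * (b - a) ≤ b ^ p := by
  have h := one_add_mul_self_le_rpow_one_add (s := b / a - 1) (by linarith [div_nonneg hb ha.le]) hp
  rw [add_sub_cancel, Real.div_rpow hb ha.le, le_div_iff₀ (by positivity)] at h
  have h2 : a ^ (p - 1) * a = a ^ p := by
    rw [← Real.rpow_add_one ha.ne', sub_add_cancel]
  calc _ = (1 + p * (b / a - 1)) * a ^ p := by rw [← h2]; field_simp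
    _ ≤ _ := h

/-- Greedy selection of pairs `(center, radius)` in order of decreasing radius: an uncovered center
is in conflict with the selection at every radius. -/
lemma exists_greedy_selection {V : Type*} [Fintype V] (d : V → V → ℕ) (hd : ∀ x y, d x y = d y x)
    (hd0 : ∀ x, d x x = 0)
    (bad : V × ℕ → V × ℕ → Prop) (hbad : ∀ x y, bad x y → bad y x) (A B : ℕ) :
    ∃ F : Finset (V × ℕ), (∀ x ∈ F, A ≤ x.2 ∧ x.2 ≤ B) ∧
      (∀ x ∈ F, ∀ y ∈ F, x ≠ y → x.2 < d x.1 y.1 ∧ ¬ bad x y) ∧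
      ∀ p, (∀ x ∈ F, x.2 < d x.1 p) → ∀ s, A ≤ s → s ≤ B → ∃ x ∈ F, bad x (p, s) := by
  classical
  obtain ⟨n, hn⟩ : ∃ n, B + 1 ≤ A + n := ⟨B + 1, by omega⟩
  induction n generalizing A with
  | zero => exact ⟨∅, by simp, by simp, fun p _ s h1 h2 => by omega⟩
  | succ n ih =>
    rcases lt_or_ge B A with hAB | hAB
    · exact ⟨∅, by simp, by simp, fun p _ s h1 h2 => by omega⟩
    obtain ⟨F₀, h1, h2, h3⟩ := ih (A + 1) (by omega)
    let P : Finset (V × ℕ) → Prop := fun F => (∀ x ∈ F, A ≤ x.2 ∧ x.2 ≤ B) ∧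
      (∀ x ∈ F, ∀ y ∈ F, x ≠ y → x.2 < d x.1 y.1 ∧ ¬ bad x y)
    have hmem : F₀ ∈ (Finset.univ ×ˢ Finset.Icc A B : Finset (V × ℕ)).powerset.filter P := by
      simp only [Finset.mem_filter, Finset.mem_powerset]
      refine ⟨fun x hx => ?_, fun x hx => ?_, h2⟩
      · have := h1 x hx
        simp; omega
      · have := h1 x hx
        omega
    obtain ⟨F, hF₀, hF⟩ := Finset.exists_le_maximal _ hmem
    have hPF : P F := (Finset.mem_filter.1 hF.prop).2
    refine ⟨F, hPF.1, hPF.2, fun p hp s hAs hsB => ?_⟩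
    rcases hAs.lt_or_eq with hlt | rfl
    · obtain ⟨x, hx, hb⟩ := h3 p (fun x hx => hp x (hF₀ hx)) s hlt hsB
      exact ⟨x, hF₀ hx, hb⟩
    by_contra! hcon
    have hP : P (insert (p, A) F) := by
      refine ⟨fun x hx => ?_, fun x hx y hy hxy => ?_⟩
      · rcases Finset.mem_insert.1 hx with rfl | hx
        · exact ⟨le_rfl, hAB⟩
        · exact hPF.1 x hx
      · rcases Finset.mem_insert.1 hx with rfl | hx <;> rcases Finset.mem_insert.1 hy with rfl | hy
        · exact absurd rfl hxy
        · refine ⟨?_, fun hb => hcon y hy (hbad _ _ hb)⟩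
          rw [hd]
          exact (hPF.1 y hy).1.trans_lt (hp y hy)
        · exact ⟨hp x hx, hcon x hx⟩
        · exact hPF.2 x hx y hy hxy
    have hle : insert (p, A) F ⊆ F := by
      refine hF.le_of_ge (Finset.mem_filter.2 ⟨Finset.mem_powerset.2 fun x hx => ?_, hP⟩)
        (Finset.subset_insert _ _)
      have := hP.1 x hx
      simp; omega
    have hpF := hle (Finset.mem_insert_self _ _)
    exact absurd (hp _ hpF) (by simp [hd0])

lemma le_ncard_ball {V : Type*} [Finite V] (G : SimpleGraph V) {β vs : ℝ} (hβ : 1 ≤ β)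
    (hvs : 0 ≤ vs) (q : V) (ρ : ℕ)
    (h : ∀ k : ℕ, 0 < k → k ≤ ρ → vs * (k : ℝ) ^ (β - 1) ≤ ((gsphere G q k).ncard : ℝ)) :
    vs * (ρ : ℝ) ^ β ≤ β * ({x | G.dist q x ≤ ρ}.ncard : ℝ) := by
  induction ρ with
  | zero =>
    rw [Nat.cast_zero, Real.zero_rpow (by linarith), mul_zero]
    positivity
  | succ ρ ih =>
    have ih := ih fun k h0 hk => h k h0 (by omega)
    have hs := h (ρ + 1) (by omega) le_rfl
    have hU : {x | G.dist q x ≤ ρ + 1} = {x | G.dist q x ≤ ρ} ∪ gsphere G q (ρ + 1) := by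
      ext x
      simp only [gsphere, Set.mem_ofPred_eq, Set.mem_union]
      omega
    have hD : Disjoint {x | G.dist q x ≤ ρ} (gsphere G q (ρ + 1)) := by
      rw [Set.disjoint_left]
      intro x
      simp only [gsphere, Set.mem_ofPred_eq]
      omega
    rw [hU, Set.ncard_union_eq hD]
    have ht := rpow_tangent_le (a := (ρ : ℝ) + 1) (b := ρ) (by positivity) (by positivity) hβ
    push_cast at hs ⊢
    nlinarith [mul_le_mul_of_nonneg_left ht hvs, mul_le_mul_of_nonneg_left hs (by linarith : 0 ≤ β)]

lemma ncard_punctured_ball_le {V : Type*} [Finite V] (G : SimpleGraph V) {β vh : ℝ} (hβ : 1 ≤ β)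
    (hvh : 0 ≤ vh) (q : V) (m : ℕ)
    (h : ∀ k : ℕ, 0 < k → k ≤ m → ((gsphere G q k).ncard : ℝ) ≤ vh * (k : ℝ) ^ (β - 1)) :
    β * ({x | 0 < G.dist q x ∧ G.dist q x ≤ m}.ncard : ℝ) ≤ vh * ((m : ℝ) + 1) ^ β := by
  induction m with
  | zero =>
    have : {x | 0 < G.dist q x ∧ G.dist q x ≤ 0} = ∅ := by
      refine Set.eq_empty_of_forall_notMem ?_
      rintro x ⟨h1, h2⟩
      omega
    rw [this]
    simp [hvh]
  | succ m ih =>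
    have ih := ih fun k h0 hk => h k h0 (by omega)
    have hs := h (m + 1) (by omega) le_rfl
    have hU : {x | 0 < G.dist q x ∧ G.dist q x ≤ m + 1} =
        {x | 0 < G.dist q x ∧ G.dist q x ≤ m} ∪ gsphere G q (m + 1) := by
      ext x
      simp only [gsphere, Set.mem_ofPred_eq, Set.mem_union]
      omega
    have hD : Disjoint {x | 0 < G.dist q x ∧ G.dist q x ≤ m} (gsphere G q (m + 1)) := by
      rw [Set.disjoint_left]
      intro x
      simp only [gsphere, Set.mem_ofPred_eq]
      omega
    rw [hU, Set.ncard_union_eq hD]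
    have ht := rpow_tangent_le (a := (m : ℝ) + 1) (b := (m : ℝ) + 1 + 1) (by positivity)
      (by positivity) hβ
    push_cast at hs ⊢
    nlinarith [mul_le_mul_of_nonneg_left ht hvh, mul_le_mul_of_nonneg_left hs (by linarith : 0 ≤ β)]

/-- Disjoint balls inside a set `T` have total volume at most that of `T`. -/
lemma sum_rpow_le_of_disjoint_balls {V ι : Type*} [Finite V] {G : SimpleGraph V}
    (hconn : G.Connected) {β vs : ℝ} (hβ : 1 ≤ β) (hvs : 0 ≤ vs) (s : Finset ι) (c : ι → V)
    (ρ : ι → ℕ) (hdisj : ∀ i ∈ s, ∀ j ∈ s, i ≠ j → ρ i + ρ j < G.dist (c i) (c j))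
    (h : ∀ i ∈ s, ∀ k : ℕ, 0 < k → k ≤ ρ i →
      vs * (k : ℝ) ^ (β - 1) ≤ ((gsphere G (c i) k).ncard : ℝ))
    (T : Set V) (hT : ∀ i ∈ s, ∀ x, G.dist (c i) x ≤ ρ i → x ∈ T) :
    vs * ∑ i ∈ s, (ρ i : ℝ) ^ β ≤ β * (T.ncard : ℝ) := by
  classical
  have := Fintype.ofFinite V
  have hcard : ∑ i ∈ s, {x | G.dist (c i) x ≤ ρ i}.ncard ≤ T.ncard := by
    simp only [Set.ncard_eq_toFinset_card']
    rw [← Finset.card_biUnion]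
    · apply Finset.card_le_card
      intro x hx
      simp only [Finset.mem_biUnion, Set.mem_toFinset, Set.mem_ofPred_eq] at hx ⊢
      obtain ⟨i, hi, hx⟩ := hx
      exact hT i hi x hx
    · intro i hi j hj hij
      rw [Function.onFun, Finset.disjoint_left]
      intro x hxi hxj
      simp only [Set.mem_toFinset, Set.mem_ofPred_eq] at hxi hxj
      have h1 := hdisj i hi j hj hij
      have h2 := hconn.dist_triangle (u := c i) (v := x) (w := c j)
      rw [G.dist_comm (u := x)] at h2
      omega
  calc vs * ∑ i ∈ s, (ρ i : ℝ) ^ β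
      ≤ β * ∑ i ∈ s, ({x | G.dist (c i) x ≤ ρ i}.ncard : ℝ) := by
        rw [Finset.mul_sum, Finset.mul_sum]
        exact Finset.sum_le_sum fun i hi => le_ncard_ball G hβ hvs _ _ (h i hi)
    _ ≤ _ := by
        gcongr
        exact_mod_cast hcard

/-- Disjoint balls inside a punctured ball about `p`. -/
lemma sum_rpow_le_of_disjoint_balls_near {V ι : Type*} [Finite V] {G : SimpleGraph V}
    (hconn : G.Connected) {β vs vh : ℝ} (hβ : 1 ≤ β) (hvs : 0 ≤ vs) (hvh : 0 ≤ vh) (m : ℕ)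
    (hreg : ∀ q : V, ∀ k : ℕ, 0 < k → k ≤ m →
      vs * (k : ℝ) ^ (β - 1) ≤ ((gsphere G q k).ncard : ℝ) ∧
      ((gsphere G q k).ncard : ℝ) ≤ vh * (k : ℝ) ^ (β - 1))
    (s : Finset ι) (c : ι → V) (ρ : ι → ℕ)
    (hdisj : ∀ i ∈ s, ∀ j ∈ s, i ≠ j → ρ i + ρ j < G.dist (c i) (c j)) (p : V)
    (hp : ∀ i ∈ s, ρ i < G.dist p (c i) ∧ G.dist p (c i) + ρ i ≤ m) :
    vs * ∑ i ∈ s, (ρ i : ℝ) ^ β ≤ vh * ((m : ℝ) + 1) ^ β := by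
  refine (sum_rpow_le_of_disjoint_balls hconn hβ hvs s c ρ hdisj
    (fun i hi k h0 hk => (hreg _ k h0 (by have := hp i hi; omega)).1)
    {x | 0 < G.dist p x ∧ G.dist p x ≤ m} fun i hi x hx => ?_).trans
    (ncard_punctured_ball_le G hβ hvh p m fun k h0 hk => (hreg p k h0 hk).2)
  have h1 := hp i hi
  have h2 := hconn.dist_triangle (u := p) (v := c i) (w := x)
  have h3 := hconn.dist_triangle (u := p) (v := x) (w := c i)
  rw [G.dist_comm (u := x)] at h3
  simp only [Set.mem_ofPred_eq]
  omega

/-- The midpoint of a pair at distance two has at least two neighbors. -/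
lemma exists_two_le_ncard_sphere_one {V : Type*} [Finite V] {G : SimpleGraph V}
    (hconn : G.Connected) {p q : V} (h : G.dist p q = 2) : ∃ m, 2 ≤ (gsphere G m 1).ncard := by
  obtain ⟨w, hw⟩ := hconn.exists_walk_length_eq_dist p q
  rw [h] at hw
  match w, hw with
  | .cons (v := m) h1 (.cons h2 .nil), _ =>
    refine ⟨m, ?_⟩
    have hne : p ≠ q := by
      rintro rfl
      simp at h
    rw [← Set.ncard_pair hne]
    refine Set.ncard_le_ncard ?_
    rintro x (rfl | rfl)
    · exact SimpleGraph.dist_eq_one_iff_adj.2 h1.symm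
    · exact SimpleGraph.dist_eq_one_iff_adj.2 h2

/-- Markov's inequality for the number of level sets of `f` with large intersection with `T`. -/
lemma card_large_slices_mul_le {V : Type*} [Finite V] (f : V → ℤ) (T : Set V) (I : Finset ℕ)
    (δ : ℤ) {w : ℝ} :
    ((I.filter fun s : ℕ => w < (({x | f x = s + δ} ∩ T).ncard : ℝ)).card : ℝ) * w ≤
      (T.ncard : ℝ) := by
  classical
  have := Fintype.ofFinite V
  set J := I.filter fun s : ℕ => w < (({x | f x = s + δ} ∩ T).ncard : ℝ)
  have hcard : ∑ s ∈ J, ({x | f x = s + δ} ∩ T).ncard ≤ T.ncard := by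
    simp only [Set.ncard_eq_toFinset_card']
    rw [← Finset.card_biUnion]
    · apply Finset.card_le_card
      intro x hx
      simp only [Finset.mem_biUnion, Set.mem_toFinset] at hx ⊢
      obtain ⟨i, hi, hx⟩ := hx
      exact hx.2
    · intro i hi j hj hij
      rw [Function.onFun, Finset.disjoint_left]
      intro x hxi hxj
      simp only [Set.mem_toFinset, Set.mem_inter_iff, Set.mem_ofPred_eq] at hxi hxj
      omega
  rw [← nsmul_eq_mul]
  refine (Finset.card_nsmul_le_sum J (fun s => (({x | f x = s + δ} ∩ T).ncard : ℝ)) w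
    fun s hs => (Finset.mem_filter.1 hs).2.le).trans ?_
  exact_mod_cast hcard

lemma gsphereZ_natCast {V : Type*} (G : SimpleGraph V) (q : V) (k : ℕ) :
    gsphereZ G q (k : ℤ) = gsphere G q k := by
  ext x
  simp [gsphereZ, gsphere]

/-- Two spheres `(center, radius)` conflict at threshold `w` if, after changing one of the radii by
at most one, their intersection has more than `w` points. -/
def SphereConflict {V : Type*} (G : SimpleGraph V) (w : ℝ) (x y : V × ℕ) : Prop :=
  ∃ δ : ℤ, (δ = -1 ∨ δ = 0 ∨ δ = 1) ∧
    (w < ((gsphereZ G x.1 ((x.2 : ℤ) + δ) ∩ gsphereZ G y.1 (y.2 : ℤ)).ncard : ℝ) ∨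
      w < ((gsphereZ G y.1 ((y.2 : ℤ) + δ) ∩ gsphereZ G x.1 (x.2 : ℤ)).ncard : ℝ))

lemma SphereConflict.symm {V : Type*} {G : SimpleGraph V} {w : ℝ} {x y : V × ℕ}
    (h : SphereConflict G w x y) : SphereConflict G w y x := by
  obtain ⟨δ, hδ, h⟩ := h
  exact ⟨δ, hδ, h.symm⟩

lemma SphereConflict.dist_le {V : Type*} {G : SimpleGraph V} (hconn : G.Connected) {w : ℝ}
    (hw : 0 ≤ w) {x y : V × ℕ} (h : SphereConflict G w x y) :
    G.dist y.1 x.1 ≤ x.2 + y.2 + 1 := by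
  obtain ⟨δ, hδ, h⟩ := h
  have key : ∀ S : Set V, w < (S.ncard : ℝ) → S.Nonempty := fun S hS => by
    refine Set.nonempty_of_ncard_ne_zero fun h0 => ?_
    rw [h0, Nat.cast_zero] at hS
    linarith
  have tri := fun z => hconn.dist_triangle (u := y.1) (v := z) (w := x.1)
  simp only [G.dist_comm (v := x.1)] at tri
  rcases h with h | h <;> obtain ⟨z, hz1, hz2⟩ := key _ h <;>
  · simp only [gsphereZ, Set.mem_ofPred_eq] at hz1 hz2
    have := tri z
    simp only [G.dist_comm (u := x.1)] at *
    omega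

/-- A sphere conflicts with few of the spheres about `p`. -/
lemma card_conflict_mul_le {V : Type*} [Finite V] (G : SimpleGraph V) {w b : ℝ} (hw : 0 ≤ w)
    (p q : V) {t : ℕ} (ht : 0 < t) (I : Finset ℕ)
    (hb : ∀ k : ℕ, t - 1 ≤ k → k ≤ t + 1 → ((gsphere G q k).ncard : ℝ) ≤ b)
    [DecidablePred fun s => SphereConflict G w (q, t) (p, s)] :
    ((I.filter fun s => SphereConflict G w (q, t) (p, s)).card : ℝ) * w ≤ 5 * b := by
  classical
  have h1 := fun δ : ℤ => card_large_slices_mul_le (fun x => (G.dist p x : ℤ))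
    (gsphereZ G q (t : ℤ)) I δ (w := w)
  have h2 := fun δ : ℤ => card_large_slices_mul_le (fun x => (G.dist p x : ℤ))
    (gsphereZ G q ((t : ℤ) + δ)) I 0 (w := w)
  have b0 : ((gsphereZ G q (t : ℤ)).ncard : ℝ) ≤ b := by
    rw [gsphereZ_natCast]
    exact hb t (by omega) (by omega)
  have b1 : ((gsphereZ G q ((t : ℤ) + 1)).ncard : ℝ) ≤ b := by
    have := hb (t + 1) (by omega) le_rfl
    rw [← gsphereZ_natCast] at this
    exact_mod_cast this
  have b2 : ((gsphereZ G q ((t : ℤ) + -1)).ncard : ℝ) ≤ b := by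
    have := hb (t - 1) le_rfl (by omega)
    rwa [← gsphereZ_natCast, Nat.cast_sub ht, Nat.cast_one] at this
  set A : ℤ → Finset ℕ := fun δ => I.filter fun s : ℕ =>
    w < (({x | (G.dist p x : ℤ) = s + δ} ∩ gsphereZ G q (t : ℤ)).ncard : ℝ) with hA
  set B : ℤ → Finset ℕ := fun δ => I.filter fun s : ℕ =>
    w < (({x | (G.dist p x : ℤ) = s + 0} ∩ gsphereZ G q ((t : ℤ) + δ)).ncard : ℝ) with hB
  have hsub : (I.filter fun s => SphereConflict G w (q, t) (p, s)) ⊆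
      A (-1) ∪ A 0 ∪ A 1 ∪ B (-1) ∪ B 1 := by
    intro s hs
    obtain ⟨hsI, δ, hδ, h⟩ := Finset.mem_filter.1 hs
    have hmem : s ∈ A δ ∨ s ∈ B δ := by
      rcases h with h | h
      · right
        refine Finset.mem_filter.2 ⟨hsI, ?_⟩
        rw [add_zero, Set.inter_comm]
        exact h
      · exact .inl (Finset.mem_filter.2 ⟨hsI, h⟩)
    have h0 : B 0 = A 0 := by simp [hA, hB]
    simp only [Finset.mem_union]
    rcases hδ with rfl | rfl | rfl
    · tauto
    · rw [h0] at hmem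
      tauto
    · tauto
  have hcard : (I.filter fun s => SphereConflict G w (q, t) (p, s)).card ≤
      (A (-1)).card + (A 0).card + (A 1).card + (B (-1)).card + (B 1).card := by
    refine (Finset.card_le_card hsub).trans ?_
    have i1 := Finset.card_union_le (A (-1)) (A 0)
    have i2 := Finset.card_union_le (A (-1) ∪ A 0) (A 1)
    have i3 := Finset.card_union_le (A (-1) ∪ A 0 ∪ A 1) (B (-1))
    have i4 := Finset.card_union_le (A (-1) ∪ A 0 ∪ A 1 ∪ B (-1)) (B 1)
    omega
  have hcard' : ((I.filter fun s => SphereConflict G w (q, t) (p, s)).card : ℝ) ≤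
      (A (-1)).card + (A 0).card + (A 1).card + (B (-1)).card + (B 1).card := by
    exact_mod_cast hcard
  linarith [mul_le_mul_of_nonneg_right hcard' hw, h1 (-1), h1 0, h1 1, h2 (-1), h2 1]

/-- The threshold is of no consequence at small scales. -/
lemma sphere_bound_le_threshold {β vs vh r : ℝ} (hvs : 0 < vs) (hvv : vs ≤ vh) (hβ : 2 ≤ β)
    (hr0 : 0 < r) (hr : r ≤ 300) :
    vh * (2 * r) ^ (β - 1) ≤ 3 * 2 ^ (β - 1) * ((vh / vs) * 10 ^ β) * vh * r ^ (β - 2) := by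
  have hvh : 0 < vh := by linarith
  have h1 : 1 ≤ vh / vs := (one_le_div hvs).2 hvv
  have h2 : (100 : ℝ) ≤ 10 ^ β := by
    calc (100 : ℝ) = 10 ^ (2 : ℝ) := by norm_num
      _ ≤ _ := Real.rpow_le_rpow_of_exponent_le (by norm_num) hβ
  have h3 : r ^ (β - 1) = r * r ^ (β - 2) := by
    rw [← Real.rpow_one_add' hr0.le (by linarith)]
    congr 1
    ring
  rw [Real.mul_rpow (by norm_num) hr0.le, h3]
  have h4 : r ≤ 3 * ((vh / vs) * 10 ^ β) := by nlinarith
  calc vh * (2 ^ (β - 1) * (r * r ^ (β - 2)))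
      = r * (2 ^ (β - 1) * vh * r ^ (β - 2)) := by ring
    _ ≤ 3 * ((vh / vs) * 10 ^ β) * (2 ^ (β - 1) * vh * r ^ (β - 2)) := by gcongr
    _ = _ := by ring

lemma threshold_mul_sq {β vs vh r : ℝ} (hvs : 0 < vs) (hr : 0 < r) :
    vs * (r ^ 2 * (3 * 2 ^ (β - 1) * ((vh / vs) * 10 ^ β) * vh * r ^ (β - 2))) =
      3 / 2 * vh ^ 2 * (20 * r) ^ β := by
  have h1 : r ^ (β - 2) = r ^ β / r ^ 2 := by
    rw [Real.rpow_sub hr, Real.rpow_two]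
  rw [h1, Real.rpow_sub_one (by norm_num), Real.mul_rpow (by norm_num) hr.le,
    show (20 : ℝ) = 2 * 10 by norm_num, Real.mul_rpow (by norm_num) (by norm_num)]
  field_simp

lemma five_mul_rpow_lt {β r : ℝ} (hβ : 2 ≤ β) (hr : 0 < r) :
    5 * (10.23 * r) ^ β < 3 / 2 * (20 * r) ^ β := by
  have h1 : (10.23 * r) ^ β = 0.5115 ^ β * (20 * r) ^ β := by
    rw [← Real.mul_rpow (by norm_num) (by positivity)]
    congr 1
    ring
  have h2 : (0.5115 : ℝ) ^ β ≤ 0.5115 ^ (2 : ℝ) :=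
    Real.rpow_le_rpow_of_exponent_ge (by norm_num) (by norm_num) hβ
  rw [h1]
  have h3 : (0 : ℝ) < (20 * r) ^ β := by positivity
  norm_num at h2
  nlinarith

/-- At large scales, an uncovered center does not conflict with the selection at every radius. -/
lemma exists_radius_without_conflict {V : Type*} [Finite V] {G : SimpleGraph V}
    (hconn : G.Connected) {β vs vh : ℝ} (hβ : 2 ≤ β) (hvs : 0 < vs) (hvh : 0 < vh) {R : ℕ}
    (hR : 300 < R)
    (hreg : ∀ q : V, ∀ k : ℕ, 0 < k → k ≤ 5 * R →
      vs * (k : ℝ) ^ (β - 1) ≤ ((gsphere G q k).ncard : ℝ) ∧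
      ((gsphere G q k).ncard : ℝ) ≤ vh * (k : ℝ) ^ (β - 1))
    (F : Finset (V × ℕ)) (hF : ∀ x ∈ F, R + 1 ≤ x.2 ∧ x.2 ≤ 2 * R)
    (hsep : ∀ x ∈ F, ∀ y ∈ F, x ≠ y → x.2 < G.dist x.1 y.1)
    (p : V) (hp : ∀ x ∈ F, x.2 < G.dist x.1 p) :
    ∃ s, R + 1 ≤ s ∧ s ≤ 2 * R ∧ ∀ x ∈ F, ¬ SphereConflict G
      (3 * 2 ^ (β - 1) * ((vh / vs) * 10 ^ β) * vh * (R : ℝ) ^ (β - 2)) x (p, s) := by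
  classical
  by_contra! hcon
  have hR' : (300 : ℝ) < R := by exact_mod_cast hR
  have hw2 := threshold_mul_sq (β := β) (vh := vh) hvs (by linarith : (0 : ℝ) < R)
  have hw : 0 ≤ 3 * 2 ^ (β - 1) * ((vh / vs) * 10 ^ β) * vh * (R : ℝ) ^ (β - 2) := by positivity
  set w := 3 * 2 ^ (β - 1) * ((vh / vs) * 10 ^ β) * vh * (R : ℝ) ^ (β - 2)
  set I := Finset.Icc (R + 1) (2 * R) with hI
  set J := F.filter fun x => ∃ s ∈ I, SphereConflict G w x (p, s) with hJ
  set ρ : V × ℕ → ℕ := fun x => x.2 / 2 - 1 with hρ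
  have hJdist : ∀ x ∈ J, ρ x < G.dist p x.1 ∧ G.dist p x.1 + ρ x ≤ 5 * R := by
    intro x hx
    obtain ⟨hxF, s, hs, hc⟩ := Finset.mem_filter.1 hx
    have h1 := hc.dist_le hconn hw
    have h2 := hp x hxF
    have h3 := hF x hxF
    rw [G.dist_comm] at h2
    rw [Finset.mem_Icc] at hs
    simp only [hρ] at h1 ⊢
    omega
  have hpack := sum_rpow_le_of_disjoint_balls_near hconn (by linarith) hvs.le hvh.le (5 * R) hreg
    J Prod.fst ρ (fun x hx y hy hxy => by
      have h1 := hsep x (Finset.mem_filter.1 hx).1 y (Finset.mem_filter.1 hy).1 hxy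
      have h2 := hsep y (Finset.mem_filter.1 hy).1 x (Finset.mem_filter.1 hx).1 hxy.symm
      rw [G.dist_comm] at h2
      simp only [hρ]
      omega) p hJdist
  have hcover : (R : ℝ) * w ≤
      ∑ x ∈ J, ((I.filter fun s => SphereConflict G w x (p, s)).card : ℝ) * w := by
    rw [← Finset.sum_mul]
    refine mul_le_mul_of_nonneg_right ?_ hw
    have : I ⊆ J.biUnion fun x => I.filter fun s => SphereConflict G w x (p, s) := by
      intro s hs
      obtain ⟨x, hx, hc⟩ := hcon s (Finset.mem_Icc.1 hs).1 (Finset.mem_Icc.1 hs).2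
      exact Finset.mem_biUnion.2 ⟨x, Finset.mem_filter.2 ⟨hx, s, hs, hc⟩,
        Finset.mem_filter.2 ⟨hs, hc⟩⟩
    have h1 := (Finset.card_le_card this).trans Finset.card_biUnion_le
    rw [hI, Nat.card_Icc, show 2 * R + 1 - (R + 1) = R by omega, ← hI] at h1
    exact_mod_cast h1
  have hterm : ∀ x ∈ J, ((I.filter fun s => SphereConflict G w x (p, s)).card : ℝ) * w ≤
      5 * vh * 2.04 ^ β / R * (ρ x : ℝ) ^ β := by
    intro x hx
    have hxF := hF x (Finset.mem_filter.1 hx).1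
    have ht : (R : ℝ) + 1 ≤ x.2 := by exact_mod_cast hxF.1
    refine (card_conflict_mul_le G hw p x.1 (t := x.2) (b := vh * ((x.2 : ℝ) + 1) ^ (β - 1))
      (by omega) I fun k hk1 hk2 => ?_).trans ?_
    · refine (hreg x.1 k (by omega) (by omega)).2.trans ?_
      have : (k : ℝ) ≤ x.2 + 1 := by exact_mod_cast hk2
      gcongr
      linarith
    · have h1 : (x.2 : ℝ) + 1 ≤ 2.04 * (ρ x : ℝ) := by
        have : x.2 ≤ 2 * ρ x + 3 := by
          simp only [hρ]
          omega
        have : (x.2 : ℝ) ≤ 2 * ρ x + 3 := by exact_mod_cast this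
        linarith
      have h2 : ((x.2 : ℝ) + 1) ^ (β - 1) ≤ 2.04 ^ β * (ρ x : ℝ) ^ β / R := by
        rw [← Real.mul_rpow (by norm_num) (by positivity), le_div_iff₀ (by linarith)]
        calc ((x.2 : ℝ) + 1) ^ (β - 1) * R ≤ ((x.2 : ℝ) + 1) ^ (β - 1) * ((x.2 : ℝ) + 1) := by
              gcongr
              linarith
          _ = ((x.2 : ℝ) + 1) ^ β := by
              rw [← Real.rpow_add_one (by positivity), sub_add_cancel]
          _ ≤ _ := by gcongr
      calc _ ≤ 5 * (vh * (2.04 ^ β * (ρ x : ℝ) ^ β / R)) := by gcongr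
        _ = _ := by ring
  have hsum := hcover.trans (Finset.sum_le_sum hterm)
  rw [← Finset.mul_sum, div_mul_eq_mul_div, le_div_iff₀ (by linarith)] at hsum
  have hlt := five_mul_rpow_lt hβ (by linarith : (0 : ℝ) < R)
  have hbase : (2.04 : ℝ) ^ β * (((5 * R : ℕ) : ℝ) + 1) ^ β ≤ (10.23 * R) ^ β := by
    rw [← Real.mul_rpow (by norm_num) (by positivity)]
    refine Real.rpow_le_rpow (by positivity) ?_ (by linarith)
    push_cast
    linarith
  have : 3 / 2 * vh ^ 2 * (20 * (R : ℝ)) ^ β ≤ 5 * vh ^ 2 * (10.23 * R) ^ β := by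
    calc 3 / 2 * vh ^ 2 * (20 * (R : ℝ)) ^ β = vs * (R * w * R) := by rw [← hw2]; ring
      _ ≤ vs * (5 * vh * 2.04 ^ β * ∑ x ∈ J, (ρ x : ℝ) ^ β) := by gcongr
      _ = 5 * vh * 2.04 ^ β * (vs * ∑ x ∈ J, (ρ x : ℝ) ^ β) := by ring
      _ ≤ 5 * vh * 2.04 ^ β * (vh * (((5 * R : ℕ) : ℝ) + 1) ^ β) := by gcongr
      _ = 5 * vh ^ 2 * (2.04 ^ β * (((5 * R : ℕ) : ℝ) + 1) ^ β) := by ring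
      _ ≤ _ := by gcongr
  nlinarith [mul_lt_mul_of_pos_left hlt (by positivity : 0 < vh ^ 2)]

lemma one_le_of_sphere_bounds {V : Type*} [Finite V] {G : SimpleGraph V} (hconn : G.Connected)
    {vh : ℝ} (h1 : ∀ q, ((gsphere G q 1).ncard : ℝ) ≤ max vh 1)
    (h2 : ∀ q, 0 < (gsphere G q 2).ncard) : 1 ≤ vh := by
  obtain ⟨q⟩ := hconn.nonempty
  obtain ⟨p, hp⟩ := (Set.ncard_pos).1 (h2 q)
  obtain ⟨m, hm⟩ := exists_two_le_ncard_sphere_one hconn hp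
  have hm' : (2 : ℝ) ≤ (gsphere G m 1).ncard := by exact_mod_cast hm
  by_contra! hlt
  have := h1 m
  rw [max_eq_right hlt.le] at this
  linarith

/-- A selection of well-separated spheres without conflicts whose balls cover the graph. -/
lemma exists_conflict_free_cover {V : Type*} [Fintype V] {G : SimpleGraph V}
    (hconn : G.Connected) {β vs vh : ℝ} (hβ : 2 ≤ β) (hvs : 0 < vs) (hvv : vs ≤ vh) {R : ℕ}
    (hR : 0 < R)
    (hreg : ∀ q : V, ∀ k : ℕ, 0 < k → k ≤ 5 * R →
      vs * (k : ℝ) ^ (β - 1) ≤ ((gsphere G q k).ncard : ℝ) ∧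
      ((gsphere G q k).ncard : ℝ) ≤ vh * (k : ℝ) ^ (β - 1)) :
    ∃ F : Finset (V × ℕ), (∀ x ∈ F, R + 1 ≤ x.2 ∧ x.2 ≤ 2 * R) ∧
      (∀ x ∈ F, ∀ y ∈ F, x ≠ y → x.2 < G.dist x.1 y.1 ∧ ¬ SphereConflict G
        (3 * 2 ^ (β - 1) * ((vh / vs) * 10 ^ β) * vh * (R : ℝ) ^ (β - 2)) x y) ∧
      ∀ p, ∃ x ∈ F, G.dist x.1 p ≤ x.2 := by
  have hvh : 0 < vh := by linarith
  have hR0 : (0 : ℝ) < R := by exact_mod_cast hR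
  obtain ⟨F, hF, hsep, hun⟩ := exists_greedy_selection G.dist (fun x y => G.dist_comm)
    (fun x => SimpleGraph.dist_self)
    (SphereConflict G (3 * 2 ^ (β - 1) * ((vh / vs) * 10 ^ β) * vh * (R : ℝ) ^ (β - 2)))
    (fun x y h => h.symm) (R + 1) (2 * R)
  refine ⟨F, hF, hsep, fun p => ?_⟩
  by_contra! hp
  rcases le_or_gt R 300 with hle | hgt
  · obtain ⟨x, hx, δ, -, hc⟩ := hun p hp (R + 1) le_rfl (by omega)
    have hsmall : ∀ (q : V) (k : ℕ), R + 1 ≤ k → k ≤ 2 * R → ∀ S : Set V,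
        ¬ 3 * 2 ^ (β - 1) * ((vh / vs) * 10 ^ β) * vh * (R : ℝ) ^ (β - 2) <
          ((S ∩ gsphereZ G q (k : ℤ)).ncard : ℝ) := by
      intro q k h1 h2 S
      rw [not_lt, gsphereZ_natCast]
      refine le_trans ?_ (sphere_bound_le_threshold hvs hvv hβ hR0 (by exact_mod_cast hle))
      have hk : (k : ℝ) ≤ 2 * R := by exact_mod_cast h2
      calc ((S ∩ gsphere G q k).ncard : ℝ) ≤ ((gsphere G q k).ncard : ℝ) := by
            exact_mod_cast Set.ncard_le_ncard Set.inter_subset_right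
        _ ≤ vh * (k : ℝ) ^ (β - 1) := (hreg q k (by omega) (by omega)).2
        _ ≤ _ := by
            gcongr
            linarith
    rcases hc with hc | hc
    · exact hsmall p (R + 1) le_rfl (by omega) _ hc
    · exact hsmall x.1 x.2 (hF x hx).1 (hF x hx).2 _ hc
  · obtain ⟨s, hs1, hs2, hs⟩ := exists_radius_without_conflict hconn hβ hvs hvh hgt hreg F hF
      (fun x hx y hy hxy => (hsep x hx y hy hxy).1) p hp
    obtain ⟨x, hx, hc⟩ := hun p hp s hs1 hs2
    exact hs x hx hc

/-- Division lemma: in a finite connected graph with strengthened Ahlfors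
`β`-regularity (`β ≥ 2`) up to scale `R̄`, for every integer scale `0 < R ≤ R̄/5`
there is a cover by at most `(2^β·β/v_*)·n/R^β` balls of radii `t_i ∈ [R+1, 2R]`
whose boundary spheres intersect at most `M = (v^*/v_*)·10^β` other boundary
spheres each, the pairwise intersections having volume at most `w₂·R^{β-2}` with
`w₂ = 3·2^{β-1}·M·v^*`. -/
theorem division_lemma {V : Type*} [Fintype V] (G : SimpleGraph V) (hconn : G.Connected)
    (β : ℝ) (hβ : 2 ≤ β) (Rbar : ℝ) (vs vh : ℝ) (hvs : 0 < vs) (hvv : vs ≤ vh)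
    (hreg : ∀ (q : V) (R : ℕ), 0 < R → (R : ℝ) ≤ Rbar →
      vs * (R : ℝ) ^ (β - 1) ≤ ((gsphere G q R).ncard : ℝ) ∧
      ((gsphere G q R).ncard : ℝ) ≤ max (vh * (R : ℝ) ^ (β - 1)) 1) :
    ∀ R : ℕ, 0 < R → (R : ℝ) ≤ Rbar / 5 →
      ∃ (l : ℕ) (q : Fin l → V) (t : Fin l → ℕ),
        (∀ i, R + 1 ≤ t i ∧ t i ≤ 2 * R) ∧
        (⋃ i, gball G (q i) ((t i : ℝ))) = Set.univ ∧
        (l : ℝ) ≤ (2 ^ β * β / vs) * (Fintype.card V : ℝ) / (R : ℝ) ^ β ∧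
        (∀ i : Fin l,
          (({j : Fin l | j ≠ i ∧
              (gsphere G (q i) (t i) ∩ gsphere G (q j) (t j)).Nonempty}).ncard : ℝ)
            ≤ (vh / vs) * 10 ^ β) ∧
        (∀ i j : Fin l, i ≠ j → ∀ δ : ℤ, δ = -1 ∨ δ = 0 ∨ δ = 1 →
          ((gsphereZ G (q i) ((t i : ℤ) + δ) ∩ gsphereZ G (q j) ((t j : ℤ))).ncard : ℝ)
            ≤ 3 * 2 ^ (β - 1) * ((vh / vs) * 10 ^ β) * vh * (R : ℝ) ^ (β - 2)) := by
  intro R hR hRbar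
  have hR1 : (1 : ℝ) ≤ R := by exact_mod_cast hR
  have hle : ∀ k : ℕ, k ≤ 5 * R → (k : ℝ) ≤ Rbar := fun k hk => by
    have : (k : ℝ) ≤ 5 * R := by exact_mod_cast hk
    linarith
  have hvh1 : 1 ≤ vh := by
    refine one_le_of_sphere_bounds hconn (fun q => ?_) fun q => ?_
    · simpa using (hreg q 1 one_pos (hle 1 (by omega))).2
    · have := (hreg q 2 two_pos (hle 2 (by omega))).1
      have h0 : 0 < vs * ((2 : ℕ) : ℝ) ^ (β - 1) := by positivity
      exact_mod_cast h0.trans_le this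
  have hreg' : ∀ q : V, ∀ k : ℕ, 0 < k → k ≤ 5 * R →
      vs * (k : ℝ) ^ (β - 1) ≤ ((gsphere G q k).ncard : ℝ) ∧
      ((gsphere G q k).ncard : ℝ) ≤ vh * (k : ℝ) ^ (β - 1) := by
    intro q k h0 hk
    refine ⟨(hreg q k h0 (hle k hk)).1, (hreg q k h0 (hle k hk)).2.trans_eq (max_eq_left ?_)⟩
    exact one_le_mul_of_one_le_of_one_le hvh1
      (Real.one_le_rpow (by exact_mod_cast h0) (by linarith))
  obtain ⟨F, hF, hsep, hcov⟩ := exists_conflict_free_cover hconn hβ hvs hvv hR hreg'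
  let e := F.equivFin
  have hne : ∀ i j, i ≠ j → (e.symm i).1 ≠ (e.symm j).1 := fun i j hij h =>
    hij (e.symm.injective (Subtype.ext h))
  have ht := fun i => hF _ (e.symm i).2
  have hd := fun i j hij => hsep _ (e.symm i).2 _ (e.symm j).2 (hne i j hij)
  have hρ : (R : ℝ) / 2 ≤ (((R + 1) / 2 : ℕ) : ℝ) := by
    have : R ≤ 2 * ((R + 1) / 2) := by omega
    have : (R : ℝ) ≤ 2 * (((R + 1) / 2 : ℕ) : ℝ) := by exact_mod_cast this
    linarith
  have hdisj : ∀ i j, i ≠ j →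
      (R + 1) / 2 + (R + 1) / 2 < G.dist (e.symm i).1.1 (e.symm j).1.1 := fun i j hij => by
    have h1 := (hd i j hij).1
    have h2 := ht i
    omega
  refine ⟨F.card, fun i => (e.symm i).1.1, fun i => (e.symm i).1.2, ht, ?_, ?_, fun i => ?_, ?_⟩
  · refine Set.eq_univ_of_forall fun p => ?_
    obtain ⟨x, hx, hxp⟩ := hcov p
    refine Set.mem_iUnion.2 ⟨e ⟨x, hx⟩, ?_⟩
    simpa [gball] using hxp
  · have h := sum_rpow_le_of_disjoint_balls hconn (by linarith) hvs.le Finset.univ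
      (fun i => (e.symm i).1.1) (fun _ => (R + 1) / 2) (fun i _ j _ hij => hdisj i j hij)
      (fun i _ k h0 hk => (hreg' _ k h0 (by omega)).1) Set.univ (fun _ _ _ _ => trivial)
    rw [Finset.sum_const, Finset.card_univ, Fintype.card_fin, nsmul_eq_mul, Set.ncard_univ,
      Nat.card_eq_fintype_card] at h
    have h2 : ((R : ℝ) / 2) ^ β ≤ (((R + 1) / 2 : ℕ) : ℝ) ^ β := by gcongr
    rw [Real.div_rpow (by positivity) (by norm_num)] at h2
    rw [le_div_iff₀ (by positivity)]
    calc (F.card : ℝ) * (R : ℝ) ^ β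
        = 2 ^ β / vs * (vs * (F.card * ((R : ℝ) ^ β / 2 ^ β))) := by field_simp
      _ ≤ 2 ^ β / vs * (vs * (F.card * (((R + 1) / 2 : ℕ) : ℝ) ^ β)) := by gcongr
      _ ≤ 2 ^ β / vs * (β * (Fintype.card V : ℝ)) := by gcongr
      _ = _ := by ring
  · classical
    set S := {j : Fin F.card | j ≠ i ∧
      (gsphere G (e.symm i).1.1 (e.symm i).1.2 ∩
        gsphere G (e.symm j).1.1 (e.symm j).1.2).Nonempty} with hS
    have h := sum_rpow_le_of_disjoint_balls_near hconn (by linarith) hvs.le (by linarith)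
      (4 * R + (R + 1) / 2) (fun q k h0 hk => hreg' q k h0 (by omega)) S.toFinset
      (fun i => (e.symm i).1.1) (fun _ => (R + 1) / 2) (fun i _ j _ hij => hdisj i j hij)
      (e.symm i).1.1 (fun j hj => by
        obtain ⟨hji, z, hz1, hz2⟩ := Set.mem_toFinset.1 hj
        have h1 := hdisj i j hji.symm
        have h2 := ht i
        have h3 := ht j
        have h4 := hconn.dist_triangle (u := (e.symm i).1.1) (v := z) (w := (e.symm j).1.1)
        rw [G.dist_comm (u := z)] at h4
        simp only [gsphere, Set.mem_ofPred_eq] at hz1 hz2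
        omega)
    rw [Finset.sum_const, nsmul_eq_mul, ← Set.ncard_eq_toFinset_card'] at h
    have h2 : (((4 * R + (R + 1) / 2 : ℕ) : ℝ) + 1) ≤ 10 * (((R + 1) / 2 : ℕ) : ℝ) := by
      have : 4 * R + (R + 1) / 2 + 1 ≤ 10 * ((R + 1) / 2) := by omega
      exact_mod_cast this
    have hpos : (0 : ℝ) < (((R + 1) / 2 : ℕ) : ℝ) := by linarith
    have h3 : vs * (S.ncard * (((R + 1) / 2 : ℕ) : ℝ) ^ β) ≤
        vh * (10 ^ β * (((R + 1) / 2 : ℕ) : ℝ) ^ β) := by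
      rw [← Real.mul_rpow (by norm_num) hpos.le]
      refine h.trans ?_
      gcongr
    rw [← mul_assoc, ← mul_assoc] at h3
    have h4 := le_of_mul_le_mul_right h3 (by positivity)
    rw [div_mul_eq_mul_div, le_div_iff₀ hvs]
    linarith
  · intro i j hij δ hδ
    by_contra! h
    exact (hd i j hij).2 ⟨δ, hδ, .inl h⟩
end

section
/- Let 𝒳 = {(G_λ,d_λ)}_{λ∈I} be a family of graphs with shortest-path metrics whose Assouad dimension at all scales is β < ∞. Then 𝒳 has Nagata dimension at most ⌊β⌋ at all scales: there exists a constant c ≥ 1 such that for every λ ∈ I and every r > 0 there exist ⌊β⌋ + 1 families 𝓑₁,…,𝓑_{⌊β⌋+1} of subsets of the vertex set of G_λ whose union covers all vertices, each family being r-separated (any two distinct members of the same family lie at distance at least r) and every member having diameter at most c·r. -/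
open Set
open scoped ENNReal

/-- The uniform covering condition with exponent `β` and constant `C` for a family of
spaces `X i` with distance functions `d i`. -/
def AssouadBoundWith {ι : Type*} (X : ι → Type*) (d : ∀ i, X i → X i → ℝ)
    (β C : ℝ) : Prop :=
  ∀ (i : ι) (x : X i) (r R : ℝ), 0 < r → r < R →
    ∃ F : Finset (X i), (F.card : ℝ) ≤ C * (R / r) ^ β ∧
      {y | d i x y ≤ R} ⊆ ⋃ z ∈ F, {y | d i z y ≤ r}

/-- `β ≥ 0` is an admissible Assouad exponent for the family. -/
def AssouadBound {ι : Type*} (X : ι → Type*) (d : ∀ i, X i → X i → ℝ) (β : ℝ) : Prop :=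
  0 ≤ β ∧ ∃ C : ℝ, 0 < C ∧ AssouadBoundWith X d β C

/-- The Assouad dimension of a family of spaces, as an element of `ℝ≥0∞`. -/
noncomputable def assouadDim {ι : Type*} (X : ι → Type*) (d : ∀ i, X i → X i → ℝ) : ℝ≥0∞ :=
  sInf {b : ℝ≥0∞ | ∃ β : ℝ, b = ENNReal.ofReal β ∧ AssouadBound X d β}

/-- In a finite pseudometric space there is a `t`-separated `t`-net. -/
theorem exists_separated_net {X : Type*} [PseudoMetricSpace X] [Finite X] {t : ℝ} (ht : 0 ≤ t) :
    ∃ S : Finset X, (∀ p ∈ S, ∀ q ∈ S, p ≠ q → t < dist p q) ∧ ∀ x, ∃ p ∈ S, dist x p ≤ t := by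
  classical
  obtain ⟨S, hS⟩ := (Set.toFinite
    {S : Finset X | ∀ p ∈ S, ∀ q ∈ S, p ≠ q → t < dist p q}).exists_maximal ⟨∅, by simp⟩
  refine ⟨S, hS.prop, fun x => ?_⟩
  by_contra! hx
  have hmem : x ∈ S := by
    refine hS.le_of_ge (y := insert x S) ?_ (Finset.subset_insert x S) (Finset.mem_insert_self x S)
    intro p hp q hq hpq
    rw [Finset.mem_insert] at hp hq
    rcases hp with rfl | hp <;> rcases hq with rfl | hq
    · exact absurd rfl hpq
    · exact hx q hq
    · rw [dist_comm]; exact hx p hp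
    · exact hS.prop p hp q hq hpq
  have := hx x hmem
  rw [dist_self] at this
  linarith

/-- A separated set in a ball has at most as many points as balls of a third of the separation
needed to cover that ball. -/
theorem card_le_of_separated {X : Type*} [PseudoMetricSpace X] {C γ : ℝ}
    (hcov : ∀ (x : X) (r R : ℝ), 0 < r → r < R → ∃ F : Finset X,
      (F.card : ℝ) ≤ C * (R / r) ^ γ ∧ {y | dist x y ≤ R} ⊆ ⋃ z ∈ F, {y | dist z y ≤ r})
    {t R : ℝ} (ht : 0 < t) (htR : t ≤ R) {S : Finset X}
    (hS : ∀ p ∈ S, ∀ q ∈ S, p ≠ q → t < dist p q) (y : X) :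
    ((S.filter (fun p => dist y p ≤ R)).card : ℝ) ≤ C * (3 * R / t) ^ γ := by
  obtain ⟨F, hF, hsub⟩ := hcov y (t / 3) R (by linarith) (by linarith)
  have hRt : R / (t / 3) = 3 * R / t := by field_simp
  rw [hRt] at hF
  refine le_trans ?_ hF
  have hex : ∀ p : X, ∃ z, p ∈ S.filter (fun p => dist y p ≤ R) → z ∈ F ∧ dist z p ≤ t / 3 := by
    intro p
    by_cases hp : p ∈ S.filter (fun p => dist y p ≤ R)
    · have := hsub (show p ∈ {y' | dist y y' ≤ R} from (Finset.mem_filter.1 hp).2)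
      simp only [mem_iUnion, mem_ofPred_eq, exists_prop] at this
      obtain ⟨z, hz⟩ := this
      exact ⟨z, fun _ => hz⟩
    · exact ⟨p, fun h => absurd h hp⟩
  choose f hf using hex
  exact_mod_cast Finset.card_le_card_of_injOn f (fun p hp => (hf p hp).1) (by
    intro p hp q hq hpq
    by_contra hne
    have h1 := (hf p hp).2
    have h2 := (hf q hq).2
    rw [← hpq, dist_comm] at h2
    have h3 := hS p (Finset.mem_filter.1 hp).1 q (Finset.mem_filter.1 hq).1 hne
    have h4 := dist_triangle_left p q (f p)
    rw [dist_comm q] at h2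
    linarith)

/-- Simultaneous averaging: given `n + 1` sequences of `T` disjoint sets, some index is
at most `n + 1` times the average size in each of the sequences. -/
theorem exists_index_card_le {X : Type*} {n T : ℕ} (hT : 0 < T) {M : ℕ → ℝ}
    (hM : ∀ m, 0 < M m) (A : ℕ → ℕ → Finset X) (B : ℕ → Finset X)
    (hAB : ∀ m i, A m i ⊆ B m) (hA : ∀ m i j, i ≠ j → Disjoint (A m i) (A m j))
    (hB : ∀ m ≤ n, ((B m).card : ℝ) ≤ M m) :
    ∃ i < T, ∀ m ≤ n, ((A m i).card : ℝ) ≤ (n + 1) / T * M m := by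
  classical
  by_contra! h
  have hT' : (0 : ℝ) < T := by exact_mod_cast hT
  have hlow : ∀ i ∈ Finset.range T,
      ((n : ℝ) + 1) / T < ∑ m ∈ Finset.range (n + 1), ((A m i).card : ℝ) / M m := by
    intro i hi
    obtain ⟨m, hm, hlt⟩ := h i (Finset.mem_range.1 hi)
    refine lt_of_lt_of_le ((lt_div_iff₀ (hM m)).2 hlt) ?_
    exact Finset.single_le_sum (f := fun m => ((A m i).card : ℝ) / M m)
      (fun k _ => div_nonneg (Nat.cast_nonneg _) (hM k).le) (Finset.mem_range.2 (by omega))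
  have hsum := Finset.sum_lt_sum_of_nonempty (Finset.nonempty_range_iff.2 hT.ne') hlow
  rw [Finset.sum_comm, Finset.sum_const, Finset.card_range, nsmul_eq_mul,
    mul_div_cancel₀ _ hT'.ne'] at hsum
  have hup : ∀ m ∈ Finset.range (n + 1),
      ∑ i ∈ Finset.range T, ((A m i).card : ℝ) / M m ≤ 1 := by
    intro m hm
    rw [← Finset.sum_div, div_le_one (hM m)]
    refine le_trans ?_ (hB m (by have := Finset.mem_range.1 hm; omega))
    rw [← Nat.cast_sum, ← Finset.card_biUnion (fun i _ j _ hij => hA m i j hij)]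
    exact_mod_cast Finset.card_le_card (Finset.biUnion_subset.2 fun i _ => hAB m i)
  have := Finset.sum_le_sum hup
  simp only [Finset.sum_const, Finset.card_range, nsmul_eq_mul, Nat.cast_add, Nat.cast_one,
    mul_one] at this
  linarith

/-- One can choose radii `ρ z ∈ [R, 2R]` for the centres `z ∈ Z` such that locally few points of
`P` are within `2s` of many of the spheres of radius `ρ z` about `z`. -/
theorem exists_radii {X : Type*} [PseudoMetricSpace X] {n T : ℕ} (hT : 0 < T)
    {s R K : ℝ} (hs : 0 < s) (hR : R = 5 * s * T) {M : ℕ → ℝ} (hMpos : ∀ m, 0 < M m)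
    (hM : ∀ m ≤ n, K * ((n + 1) / T * M m) ≤ M (m + 1)) (P Z : Finset X)
    (hP : ∀ y, ((P.filter (fun p => dist y p ≤ 5 * R)).card : ℝ) ≤ M 0)
    (hZ : ∀ y, ((Z.filter (fun z => dist y z ≤ 8 * R)).card : ℝ) ≤ K) :
    ∃ ρ : X → ℝ, (∀ z, R ≤ ρ z ∧ ρ z ≤ 2 * R) ∧ ∀ y, ∀ m ≤ n + 1,
      ((P.filter (fun p => dist y p ≤ 5 * R ∧
        m ≤ (Z.filter (fun z => |dist p z - ρ z| ≤ 2 * s)).card)).card : ℝ) ≤ M m := by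
  classical
  have hT' : (1 : ℝ) ≤ T := by exact_mod_cast hT
  have hsR : 5 * s ≤ R := by rw [hR]; nlinarith
  have hbound : ∀ (S : Finset X), S ⊆ Z → ∀ ρ : X → ℝ,
      (∀ y, ∀ m ≤ n, ((P.filter (fun p => dist y p ≤ 5 * R ∧
        m + 1 ≤ (S.filter (fun z => |dist p z - ρ z| ≤ 2 * s)).card)).card : ℝ) ≤
          (S.filter (fun z => dist y z ≤ 8 * R)).card * ((n + 1) / T * M m)) →
      ∀ y, ∀ m ≤ n + 1, ((P.filter (fun p => dist y p ≤ 5 * R ∧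
        m ≤ (S.filter (fun z => |dist p z - ρ z| ≤ 2 * s)).card)).card : ℝ) ≤ M m := by
    intro S hS ρ h y m hm
    rcases m with _ | m
    · simpa using hP y
    · refine (h y m (by omega)).trans (le_trans ?_ (hM m (by omega)))
      have hpos : 0 ≤ ((n : ℝ) + 1) / T * M m := mul_nonneg (by positivity) (hMpos m).le
      refine mul_le_mul_of_nonneg_right (le_trans ?_ (hZ y)) hpos
      exact_mod_cast Finset.card_le_card (Finset.filter_subset_filter _ hS)
  suffices hmain : ∀ S : Finset X, S ⊆ Z → ∃ ρ : X → ℝ, (∀ z, R ≤ ρ z ∧ ρ z ≤ 2 * R) ∧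
      ∀ y, ∀ m ≤ n, ((P.filter (fun p => dist y p ≤ 5 * R ∧
        m + 1 ≤ (S.filter (fun z => |dist p z - ρ z| ≤ 2 * s)).card)).card : ℝ) ≤
          (S.filter (fun z => dist y z ≤ 8 * R)).card * ((n + 1) / T * M m) by
    obtain ⟨ρ, hρ, h⟩ := hmain Z subset_rfl
    exact ⟨ρ, hρ, hbound Z subset_rfl ρ h⟩
  intro S
  induction S using Finset.induction_on with
  | empty => exact fun _ => ⟨fun _ => R, fun _ => ⟨le_rfl, by linarith⟩, by simp⟩
  | insert z S hzS ih =>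
    intro hsub
    have hSZ : S ⊆ Z := (Finset.subset_insert z S).trans hsub
    obtain ⟨ρ, hρ, hcount⟩ := ih hSZ
    obtain ⟨i, hi, hA⟩ := exists_index_card_le (n := n) hT hMpos
      (fun m i => P.filter (fun p => (dist z p ≤ 5 * R ∧
        m ≤ (S.filter (fun z => |dist p z - ρ z| ≤ 2 * s)).card) ∧
        |dist p z - (R + 5 * s * i)| ≤ 2 * s))
      (fun m => P.filter (fun p => dist z p ≤ 5 * R ∧
        m ≤ (S.filter (fun z => |dist p z - ρ z| ≤ 2 * s)).card))
      (fun m i => Finset.monotone_filter_right _ fun p _ hp => hp.1)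
      (by
        intro m i j hij
        rw [Finset.disjoint_left]
        intro p hp hq
        have h1 := abs_le.1 (Finset.mem_filter.1 hp).2.2
        have h2 := abs_le.1 (Finset.mem_filter.1 hq).2.2
        rcases lt_or_gt_of_ne hij with h | h
        · have : (i : ℝ) + 1 ≤ j := by exact_mod_cast h
          nlinarith
        · have : (j : ℝ) + 1 ≤ i := by exact_mod_cast h
          nlinarith)
      (fun m hm => hbound S hSZ ρ hcount z m (by omega))
    have hiT : (i : ℝ) ≤ T := by exact_mod_cast hi.le
    have hi5 : 5 * s * i ≤ R := by
      rw [hR]; exact mul_le_mul_of_nonneg_left hiT (by linarith)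
    have hi0 : 0 ≤ 5 * s * (i : ℝ) := by positivity
    refine ⟨Function.update ρ z (R + 5 * s * i), fun w => ?_, fun y m hm => ?_⟩
    · by_cases hw : w = z
      · subst hw
        rw [Function.update_self]
        constructor <;> linarith
      · rw [Function.update_of_ne hw]
        exact hρ w
    have hsame : ∀ p, S.filter (fun w => |dist p w - Function.update ρ z (R + 5 * s * i) w| ≤ 2 * s)
        = S.filter (fun w => |dist p w - ρ w| ≤ 2 * s) := by
      intro p
      refine Finset.filter_congr fun w hw => ?_
      rw [Function.update_of_ne (fun h : w = z => hzS (h ▸ hw))]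
    set E := P.filter (fun p => dist y p ≤ 5 * R ∧
        m ≤ (S.filter (fun z => |dist p z - ρ z| ≤ 2 * s)).card ∧
        |dist p z - (R + 5 * s * i)| ≤ 2 * s) with hE
    have hsplit : P.filter (fun p => dist y p ≤ 5 * R ∧ m + 1 ≤ ((insert z S).filter
        (fun w => |dist p w - Function.update ρ z (R + 5 * s * i) w| ≤ 2 * s)).card) ⊆
        P.filter (fun p => dist y p ≤ 5 * R ∧
          m + 1 ≤ (S.filter (fun z => |dist p z - ρ z| ≤ 2 * s)).card) ∪ E := by
      intro p hp
      simp only [Finset.mem_filter, Finset.mem_union, hE] at hp ⊢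
      obtain ⟨hpP, hyp, hc⟩ := hp
      rw [Finset.filter_insert, Function.update_self, hsame p] at hc
      split_ifs at hc with hz
      · have := hc.trans (Finset.card_insert_le _ _)
        exact Or.inr ⟨hpP, hyp, by omega, hz⟩
      · exact Or.inl ⟨hpP, hyp, hc⟩
    have hcard : ((P.filter (fun p => dist y p ≤ 5 * R ∧ m + 1 ≤ ((insert z S).filter
        (fun w => |dist p w - Function.update ρ z (R + 5 * s * i) w| ≤ 2 * s)).card)).card : ℝ) ≤
        (P.filter (fun p => dist y p ≤ 5 * R ∧
          m + 1 ≤ (S.filter (fun z => |dist p z - ρ z| ≤ 2 * s)).card)).card + E.card := by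
      exact_mod_cast (Finset.card_le_card hsplit).trans (Finset.card_union_le _ _)
    have hnear : ∀ p ∈ E, dist p z ≤ 3 * R := by
      intro p hp
      have := abs_le.1 (Finset.mem_filter.1 hp).2.2.2
      linarith
    have hold := hcount y m hm
    rw [Finset.filter_insert]
    split_ifs with hyz
    · have hEA : (E.card : ℝ) ≤ (n + 1) / T * M m := by
        refine le_trans ?_ (hA m hm)
        refine Nat.cast_le.2 (Finset.card_le_card fun p hp => ?_)
        have h1 := hnear p hp
        rw [dist_comm] at h1
        rw [hE, Finset.mem_filter] at hp
        exact Finset.mem_filter.2 ⟨hp.1, ⟨by linarith, hp.2.2.1⟩, hp.2.2.2⟩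
      rw [Finset.card_insert_of_notMem (fun h => hzS (Finset.mem_filter.1 h).1)]
      push_cast
      linarith
    · have hE0 : E = ∅ := by
        refine Finset.eq_empty_of_forall_notMem fun p hp => hyz ?_
        have h1 := hnear p hp
        have h2 := (Finset.mem_filter.1 hp).2.1
        have h3 := dist_triangle y p z
        linarith
      rw [hE0, Finset.card_empty, Nat.cast_zero] at hcard
      linarith

/-- Assigning to each point the first ball containing it gives a partition into cells; a small
ball that meets many cells is close to many of the bounding spheres. -/
theorem exists_cells {X : Type*} [PseudoMetricSpace X] [Fintype X] [DecidableEq X] {n : ℕ}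
    {s R : ℝ} {P Z : Finset X} {ρ : X → ℝ} (hP : ∀ x, ∃ p ∈ P, dist x p ≤ s)
    (hZ : ∀ x, ∃ z ∈ Z, dist x z ≤ R) (hρ : ∀ z, R ≤ ρ z ∧ ρ z ≤ 2 * R)
    (hfew : ∀ p ∈ P, (Z.filter (fun z => |dist p z - ρ z| ≤ 2 * s)).card ≤ n) :
    ∃ c : X → X, (∀ x, dist x (c x) ≤ 2 * R) ∧
      ∀ x, ((Finset.univ.filter (fun y => dist x y ≤ s)).image c).card ≤ n + 1 := by
  let e := Fintype.equivFin X
  have hex : ∀ x, ∃ z ∈ Z, dist x z ≤ ρ z ∧ ∀ w ∈ Z, dist x w ≤ ρ w → e z ≤ e w := by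
    intro x
    obtain ⟨z, hz, hzx⟩ := hZ x
    obtain ⟨w, hw, hmin⟩ := (Z.filter (fun z => dist x z ≤ ρ z)).exists_min_image e
      ⟨z, Finset.mem_filter.2 ⟨hz, hzx.trans (hρ z).1⟩⟩
    rw [Finset.mem_filter] at hw
    exact ⟨w, hw.1, hw.2, fun v hv hxv => hmin v (Finset.mem_filter.2 ⟨hv, hxv⟩)⟩
  choose c hcZ hc hmin using hex
  refine ⟨c, fun x => (hc x).trans (hρ _).2, fun x => ?_⟩
  obtain ⟨p, hp, hxp⟩ := hP x
  rcases ((Finset.univ.filter (fun y => dist x y ≤ s)).image c).eq_empty_or_nonempty with h0 | h0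
  · rw [h0]; simp
  obtain ⟨w, hw, hmax⟩ := Finset.exists_max_image _ e h0
  have hsub : ((Finset.univ.filter (fun y => dist x y ≤ s)).image c).erase w ⊆
      Z.filter (fun z => |dist p z - ρ z| ≤ 2 * s) := by
    intro z hz
    obtain ⟨hzw, hz⟩ := Finset.mem_erase.1 hz
    have hlt : e z < e w := lt_of_le_of_ne (hmax z hz) (fun h => hzw (e.injective h))
    obtain ⟨a, ha, rfl⟩ := Finset.mem_image.1 hz
    obtain ⟨b, hb, rfl⟩ := Finset.mem_image.1 hw
    have hxa := (Finset.mem_filter.1 ha).2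
    have hxb := (Finset.mem_filter.1 hb).2
    have hfar : ρ (c a) < dist b (c a) := by
      by_contra! h
      exact absurd (hmin b _ (hcZ a) h) (not_le.2 hlt)
    have hclose := hc a
    refine Finset.mem_filter.2 ⟨hcZ a, abs_le.2 ⟨?_, ?_⟩⟩
    · have h1 := dist_triangle b p (c a)
      have h2 := dist_triangle_left b p x
      linarith
    · have h1 := dist_triangle p a (c a)
      have h2 := dist_triangle_left p a x
      linarith
  have h1 := (Finset.card_le_card hsub).trans (hfew p hp)
  rw [Finset.card_erase_of_mem hw] at h1
  omega

/-- A monotone sequence of finite sets that starts nonempty and has at most `n + 1` elements at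
time `n + 1` is constant at some step. -/
theorem exists_step_eq_of_card_le {X : Type*} {n : ℕ} {f : ℕ → Finset X}
    (hf : ∀ k, f k ⊆ f (k + 1)) (h0 : (f 0).Nonempty) (hn : (f (n + 1)).card ≤ n + 1) :
    ∃ k ≤ n, f k = f (k + 1) := by
  by_contra! h
  have hgrow : ∀ k ≤ n + 1, k + 1 ≤ (f k).card := by
    intro k
    induction k with
    | zero => exact fun _ => h0.card_pos
    | succ k ih =>
      intro hk
      have h1 := ih (by omega)
      have h2 := Finset.card_lt_card ((hf k).ssubset_of_ne (h k (by omega)))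
      omega
  have := hgrow (n + 1) le_rfl
  omega

/-- A partition into cells of radius `D` such that each ball of radius `(n + 1) r` meets at most
`n + 1` cells yields `n + 1` bounded `r`-separated families that cover the space. -/
theorem exists_separated_families {X : Type*} [PseudoMetricSpace X] [Fintype X] [DecidableEq X]
    {n : ℕ} {r D : ℝ} (hr : 0 < r) {c : X → X} (hc : ∀ x, dist x (c x) ≤ D)
    (hcard : ∀ x, ((Finset.univ.filter (fun y => dist x y ≤ (n + 1) * r)).image c).card ≤ n + 1) :
    ∃ 𝓑 : Fin (n + 1) → Set (Set X), (⋃ k, ⋃ B ∈ 𝓑 k, B) = Set.univ ∧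
      (∀ k, ∀ B₁ ∈ 𝓑 k, ∀ B₂ ∈ 𝓑 k, B₁ ≠ B₂ → ∀ p ∈ B₁, ∀ q ∈ B₂, r ≤ dist p q) ∧
      (∀ k, ∀ B ∈ 𝓑 k, ∀ p ∈ B, ∀ q ∈ B, dist p q ≤ 2 * (D + n * r)) := by
  let J : ℕ → X → Finset X := fun k x =>
    (Finset.univ.filter (fun y => dist x y ≤ k * r)).image c
  have hJself : ∀ k x, c x ∈ J k x := fun k x =>
    Finset.mem_image_of_mem c (Finset.mem_filter.2 ⟨Finset.mem_univ _, by
      rw [dist_self]; positivity⟩)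
  have hJmono : ∀ k p q, dist p q ≤ r → J k p ⊆ J (k + 1) q := by
    intro k p q hpq
    refine Finset.image_subset_image fun y hy => ?_
    simp only [Finset.mem_filter, Finset.mem_univ, true_and] at hy ⊢
    have := dist_triangle_left q y p
    push_cast
    linarith
  refine ⟨fun k => Set.range fun A : Finset X => {p | J k p = A ∧ J (k + 1) p = A},
    ?_, ?_, ?_⟩
  · refine Set.eq_univ_of_forall fun x => ?_
    obtain ⟨k, hk, heq⟩ := exists_step_eq_of_card_le (n := n) (f := fun k => J k x)
      (fun k => hJmono k x x (by rw [dist_self]; exact hr.le)) ⟨_, hJself 0 x⟩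
      (by simpa [J] using hcard x)
    simp only [mem_iUnion]
    exact ⟨⟨k, by omega⟩, _, ⟨J k x, rfl⟩, rfl, heq.symm⟩
  · rintro k _ ⟨A, rfl⟩ _ ⟨A', rfl⟩ hne p ⟨hp, hp'⟩ q ⟨hq, hq'⟩
    by_contra! hlt
    refine hne ?_
    have : A = A' := subset_antisymm
      (by rw [← hp, ← hq']; exact hJmono k p q hlt.le)
      (by rw [← hq, ← hp']; exact hJmono k q p (by rw [dist_comm]; exact hlt.le))
    rw [this]
  · rintro k _ ⟨A, rfl⟩ p ⟨hp, -⟩ q ⟨hq, -⟩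
    have hmem : c p ∈ J k q := by rw [hq, ← hp]; exact hJself k p
    obtain ⟨y, hy, hyc⟩ := Finset.mem_image.1 hmem
    have hqy := (Finset.mem_filter.1 hy).2
    have hk : (k : ℝ) * r ≤ n * r :=
      mul_le_mul_of_nonneg_right (by exact_mod_cast Nat.lt_succ_iff.1 k.2) hr.le
    have h1 := hc p
    have h2 := hc y
    rw [hyc] at h2
    have h3 := dist_triangle_right p y (c p)
    have h4 := dist_triangle_right p q y
    have : 0 ≤ n * r := by positivity
    linarith

/-- A finite pseudometric space satisfying the covering condition with exponent `γ` has Nagata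
dimension at most `n` at all scales, with a constant depending on `T` only, as soon as `T` is large
in terms of `n`, `C` and `γ`. -/
theorem exists_separated_families_of_covering {X : Type*} [PseudoMetricSpace X] [Fintype X]
    {n T : ℕ} {C γ : ℝ} (hT : 0 < T) (hC : 0 < C)
    (hcov : ∀ (x : X) (r R : ℝ), 0 < r → r < R → ∃ F : Finset X,
      (F.card : ℝ) ≤ C * (R / r) ^ γ ∧ {y | dist x y ≤ R} ⊆ ⋃ z ∈ F, {y | dist z y ≤ r})
    (hsmall : C * (75 * T) ^ γ * (C * 24 ^ γ * ((n + 1) / T)) ^ (n + 1) < 1)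
    {r : ℝ} (hr : 0 < r) :
    ∃ 𝓑 : Fin (n + 1) → Set (Set X), (⋃ k, ⋃ B ∈ 𝓑 k, B) = Set.univ ∧
      (∀ k, ∀ B₁ ∈ 𝓑 k, ∀ B₂ ∈ 𝓑 k, B₁ ≠ B₂ → ∀ p ∈ B₁, ∀ q ∈ B₂, r ≤ dist p q) ∧
      (∀ k, ∀ B ∈ 𝓑 k, ∀ p ∈ B, ∀ q ∈ B, dist p q ≤ (20 * T + 2) * (n + 1) * r) := by
  classical
  have hT' : (1 : ℝ) ≤ T := by exact_mod_cast hT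
  set s : ℝ := (n + 1) * r with hs
  have hspos : 0 < s := by positivity
  set R : ℝ := 5 * s * T with hR
  have hsR : 5 * s ≤ R := by rw [hR]; nlinarith
  obtain ⟨P, hPsep, hPnet⟩ := exists_separated_net (X := X) hspos.le
  obtain ⟨Z, hZsep, hZnet⟩ := exists_separated_net (X := X) (t := R) (by linarith)
  have hP0 : 3 * (5 * R) / s = 75 * T := by rw [hR]; field_simp; norm_num
  have hZ0 : 3 * (8 * R) / R = 24 := by
    have : R ≠ 0 := by linarith
    field_simp; norm_num
  obtain ⟨ρ, hρ, hcount⟩ := exists_radii (n := n) (K := C * 24 ^ γ) hT hspos hR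
    (M := fun m => C * (75 * T) ^ γ * (C * 24 ^ γ * ((n + 1) / T)) ^ m)
    (fun m => by positivity) (fun m _ => le_of_eq (by ring)) P Z
    (fun y => by
      have := card_le_of_separated hcov hspos (by linarith : s ≤ 5 * R) hPsep y
      rw [hP0] at this
      simpa using this)
    (fun y => by
      have := card_le_of_separated hcov (by linarith : 0 < R) (by linarith : R ≤ 8 * R) hZsep y
      rwa [hZ0] at this)
  obtain ⟨c, hc, hcard⟩ := exists_cells (n := n) hPnet hZnet hρ (by
    intro p hp
    by_contra! hlt
    have h1 := (hcount p (n + 1) le_rfl).trans_lt hsmall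
    rw [Nat.cast_lt_one, Finset.card_eq_zero] at h1
    refine Finset.notMem_empty p (h1 ▸ Finset.mem_filter.2 ⟨hp, ?_, hlt⟩)
    rw [dist_self]
    linarith)
  obtain ⟨𝓑, hcover, hsep, hdiam⟩ := exists_separated_families hr hc hcard
  refine ⟨𝓑, hcover, hsep, fun k B hB p hp q hq => (hdiam k B hB p hp q hq).trans ?_⟩
  rw [hR, hs]
  nlinarith

/-- The smallness condition holds for large `T` when the exponent is below `n + 1`. -/
theorem exists_nat_covering_small {n : ℕ} {C γ : ℝ} (hγ : γ < n + 1) :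
    ∃ T : ℕ, 0 < T ∧ C * (75 * T) ^ γ * (C * 24 ^ γ * ((n + 1) / T)) ^ (n + 1) < 1 := by
  have hlim : Filter.Tendsto (fun T : ℕ =>
      C * 75 ^ γ * (C * 24 ^ γ * (n + 1)) ^ (n + 1) * (T : ℝ) ^ (-((n : ℝ) + 1 - γ)))
      Filter.atTop (nhds 0) := by
    have := ((tendsto_rpow_neg_atTop (show 0 < (n : ℝ) + 1 - γ by linarith)).comp
      tendsto_natCast_atTop_atTop).const_mul (C * 75 ^ γ * (C * 24 ^ γ * (n + 1)) ^ (n + 1))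
    simpa using this
  obtain ⟨T, hlt, hT⟩ :=
    ((hlim.eventually_lt_const one_pos).and (Filter.eventually_gt_atTop 0)).exists
  refine ⟨T, hT, lt_of_eq_of_lt ?_ hlt⟩
  have hT' : (0 : ℝ) < T := by exact_mod_cast hT
  rw [Real.mul_rpow (by norm_num) hT'.le, neg_sub, Real.rpow_sub hT', ← Nat.cast_add_one,
    Real.rpow_natCast, ← mul_div_assoc, div_pow]
  ring

/-- A family of graphs (with shortest-path metrics) of Assouad dimension `β < ∞` has
Nagata dimension at most `⌊β⌋` at all scales: there is a constant `c ≥ 1` such that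
for every graph of the family and every `r > 0` there are `⌊β⌋+1` families of vertex
sets covering the graph, each family `r`-separated and each member of diameter at
most `c·r`. -/
theorem assouad_nagata_graphs {ι : Type*} (V : ι → Type*) [∀ i, Fintype (V i)]
    (G : ∀ i, SimpleGraph (V i)) (hconn : ∀ i, (G i).Connected)
    (β : ℝ) (hβ0 : 0 ≤ β)
    (hdim : assouadDim V (fun i u v => ((G i).dist u v : ℝ)) = ENNReal.ofReal β) :
    ∃ c : ℝ, 1 ≤ c ∧ ∀ (i : ι) (r : ℝ), 0 < r →
      ∃ 𝓑 : Fin (⌊β⌋.toNat + 1) → Set (Set (V i)),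
        (⋃ k, ⋃ B ∈ 𝓑 k, B) = Set.univ ∧
        (∀ k, ∀ B₁ ∈ 𝓑 k, ∀ B₂ ∈ 𝓑 k, B₁ ≠ B₂ →
          ∀ p ∈ B₁, ∀ q ∈ B₂, r ≤ ((G i).dist p q : ℝ)) ∧
        (∀ k, ∀ B ∈ 𝓑 k, ∀ p ∈ B, ∀ q ∈ B, ((G i).dist p q : ℝ) ≤ c * r) := by
  obtain ⟨b, ⟨γ, rfl, hγ0, C, hC, hcov⟩, hlt⟩ := sInf_lt_iff.1
    (show assouadDim V (fun i u v => ((G i).dist u v : ℝ)) < ENNReal.ofReal (⌊β⌋.toNat + 1) by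
      rw [hdim, ENNReal.ofReal_lt_ofReal_iff (by positivity)]
      have h1 := Int.lt_floor_add_one β
      have h2 : (⌊β⌋ : ℝ) ≤ (⌊β⌋.toNat : ℝ) := by exact_mod_cast Int.self_le_toNat ⌊β⌋
      linarith)
  rw [ENNReal.ofReal_lt_ofReal_iff (by positivity)] at hlt
  obtain ⟨T, hT, hsmall⟩ := exists_nat_covering_small (C := C) hlt
  refine ⟨(20 * T + 2) * (⌊β⌋.toNat + 1), ?_, fun i r hr => ?_⟩
  · have h1 : (0 : ℝ) ≤ T := Nat.cast_nonneg _
    have h2 : (0 : ℝ) ≤ ⌊β⌋.toNat := Nat.cast_nonneg _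
    nlinarith
  · let _ : PseudoMetricSpace (V i) :=
      { dist := fun u v => ((G i).dist u v : ℝ)
        dist_self := fun u => by simp
        dist_comm := fun u v => by rw [SimpleGraph.dist_comm]
        dist_triangle := fun u v w => by exact_mod_cast (hconn i).dist_triangle }
    exact exists_separated_families_of_covering hT hC (hcov i) hsmall hr
end
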